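/- Let f be a Boolean function in the Reed–Muller code RM(r,v) whose weight (number of ones) is nonzero and less than 2^{v−r+1}. Then the weight of f equals 2^{v−r+1} − 2^j for some j ∈ {1,…,v−r}. -/

import Mathlib

/-- The Reed–Muller code `RM(r,v)`: Boolean functions representable by a
polynomial over `F_2` of total degree at most `r`. -/
def RM (r v : ℕ) (f : (Fin v → ZMod 2) → ZMod 2) : Prop :=
  ∃ P : MvPolynomial (Fin v) (ZMod 2),
    P.totalDegree ≤ r ∧ ∀ x, MvPolynomial.eval x P = f x

/-- The weight of a Boolean function: its number of ones. -/
def weight {v : ℕ} (f : (Fin v → ZMod 2) → ZMod 2) : ℕ :=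
  (Finset.univ.filter (fun x => f x = 1)).card

open Classical in
/-- Even intersection with all flats of dimension more than `r`. -/
def Par (r : ℕ) {V : Type} [AddCommGroup V] [Module (ZMod 2) V] [Fintype V]
    (f : V → ZMod 2) : Prop :=
  ∀ (W : Submodule (ZMod 2) V) (p : V), r < Module.finrank (ZMod 2) W →
    ∑ w : W, f (p + w) = 0

/-- local deficit -/
def gg (r : ℕ) (a : ZMod 2) : ℤ := if a = 1 then 2 - 2 ^ r else 2

lemma zmod2_cases (a : ZMod 2) : a = 0 ∨ a = 1 := by
  revert a; decide

lemma zmod2_ne_iff (a b : ZMod 2) : a ≠ b ↔ a = b + 1 := by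
  revert a b; decide

open Classical in
lemma par_restrict {r : ℕ} {V : Type} [AddCommGroup V] [Module (ZMod 2) V] [Fintype V]
    {f : V → ZMod 2} (h : Par r f) (W : Submodule (ZMod 2) V) (p : V) :
    Par r (fun w : W => f (p + w)) := by
  intro W' q hW'
  have e := W'.equivMapOfInjective W.subtype W.injective_subtype
  have h2 := h (W'.map W.subtype) (p + q) (by
    rwa [← (W'.equivMapOfInjective W.subtype W.injective_subtype).finrank_eq])
  rw [← h2]
  refine Fintype.sum_equiv
    (W'.equivMapOfInjective W.subtype W.injective_subtype).toEquiv _ _ ?_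
  intro x
  simp [add_assoc]

open Classical in
lemma flat_sum {V : Type} [AddCommGroup V] [Module (ZMod 2) V] [Fintype V]
    (W : Submodule (ZMod 2) V) (p : V) (g : V → ℤ) :
    ∑ x with x - p ∈ W, g x = ∑ w : W, g (p + w) := by
  refine Finset.sum_bij' (fun x hx => (⟨x - p, by simpa using hx⟩ : W))
    (fun w _ => p + w) ?_ ?_ ?_ ?_ ?_ <;> simp

lemma pow_ge_of_gt {T k : ℕ} (h : (2 : ℤ) ^ T < 2 ^ (k + 1)) : T ≤ k := by
  have := (pow_lt_pow_iff_right₀ (by norm_num : (1 : ℤ) < 2)).1 h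
  omega

lemma star_false {a b c d C : ℤ} {T x y z : ℕ} (hx : a + b = 2 ^ x) (hy : a + c = 2 ^ y)
    (hz : a + d = 2 ^ z) (hxT : T ≤ x) (hyT : T ≤ y) (hzT : T ≤ z)
    (ha : 0 < a → ∃ w : ℕ, a = 2 ^ w) (hC : a + b + (c + d) = C)
    (h1 : 2 ^ T < C) (h2 : C < 2 ^ (T + 1)) : False := by
  have p1 : (2 : ℤ) ^ T ≤ 2 ^ x := pow_le_pow_right₀ (by norm_num) hxT
  have p2 : (2 : ℤ) ^ T ≤ 2 ^ y := pow_le_pow_right₀ (by norm_num) hyT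
  have p3 : (2 : ℤ) ^ T ≤ 2 ^ z := pow_le_pow_right₀ (by norm_num) hzT
  have p4 : (0 : ℤ) < 2 ^ T := by positivity
  have e : (2 : ℤ) ^ (T + 1) = 2 * 2 ^ T := by ring
  obtain ⟨w, hw⟩ := ha (by linarith)
  have hw1 : T ≤ w + 1 := by
    have : (2 : ℤ) ^ T < 2 ^ (w + 1) := by
      have : (2 : ℤ) ^ (w + 1) = 2 * 2 ^ w := by ring
      rw [this, ← hw]; linarith
    have := pow_ge_of_gt this
    omega
  have dv : (2 : ℤ) ^ T ∣ C := by
    have : C = 2 ^ x + 2 ^ y + 2 ^ z - 2 ^ (w + 1) := by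
      rw [pow_succ, ← hw, ← hx, ← hy, ← hz, ← hC]; ring
    rw [this]
    exact dvd_sub (dvd_add (dvd_add (pow_dvd_pow _ hxT) (pow_dvd_pow _ hyT))
      (pow_dvd_pow _ hzT)) (pow_dvd_pow _ hw1)
  obtain ⟨k, hk⟩ := dv
  rw [hk] at h1 h2
  have : 1 < k := by
    by_contra hh
    push Not at hh
    nlinarith
  have : k < 2 := by
    by_contra hh
    push Not at hh
    nlinarith
  omega

open Classical in
lemma half_split {V : Type} [AddCommGroup V] [Module (ZMod 2) V] [Fintype V]
    (P : V → Prop) (u : V → ZMod 2) (e : ZMod 2) (g : V → ℤ) :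
    ∑ x with P x, g x = ∑ x with P x ∧ u x = e, g x + ∑ x with P x ∧ u x = e + 1, g x := by
  rw [← Finset.sum_filter_add_sum_filter_not _ (fun x => u x = e), Finset.filter_filter,
    Finset.filter_filter]
  simp only [← ne_eq, zmod2_ne_iff]

open Classical in
lemma exists_center {V : Type} [AddCommGroup V] [Module (ZMod 2) V] [Fintype V]
    (g : V → ℤ)
    (hW : ∀ (W : Submodule (ZMod 2) V) (p : V), W ≠ ⊤ → 0 < ∑ x with x - p ∈ W, g x →
      ∃ k : ℕ, ∑ x with x - p ∈ W, g x = 2 ^ k)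
    (T : ℕ) (h1 : 2 ^ T < ∑ x, g x) (h2 : ∑ x, g x < 2 ^ (T + 1)) :
    ∃ x0 : V, ∀ u : Module.Dual (ZMod 2) V, u ≠ 0 →
      2 ^ T ≤ ∑ x with u x = u x0 + 1, g x := by
  have hQ : ∀ (u v : Module.Dual (ZMod 2) V) (a b : ZMod 2), u ≠ 0 →
      0 < ∑ x with u x = a ∧ v x = b, g x →
      ∃ k : ℕ, ∑ x with u x = a ∧ v x = b, g x = 2 ^ k := by
    intro u v a b hu hpos
    have hne : (Finset.univ.filter (fun x => u x = a ∧ v x = b)).Nonempty := by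
      by_contra hh
      rw [Finset.not_nonempty_iff_eq_empty] at hh
      rw [hh] at hpos
      simp at hpos
    obtain ⟨p, hp⟩ := hne
    simp only [Finset.mem_filter, Finset.mem_univ, true_and] at hp
    have heq : (Finset.univ.filter (fun x => u x = a ∧ v x = b)) =
        Finset.univ.filter (fun x => x - p ∈ LinearMap.ker u ⊓ LinearMap.ker v) := by
      ext x
      simp [sub_eq_zero, hp.1, hp.2]
    rw [heq] at hpos ⊢
    refine hW _ p ?_ hpos
    intro ht
    apply hu
    rw [← LinearMap.ker_eq_top, eq_top_iff, ← ht]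
    exact inf_le_left
  have hH : ∀ (u : Module.Dual (ZMod 2) V) (a : ZMod 2), u ≠ 0 →
      0 < ∑ x with u x = a, g x → ∃ k : ℕ, ∑ x with u x = a, g x = 2 ^ k := by
    intro u a hu hpos
    have := hQ u u a a hu
    simp only [and_self] at this
    exact this hpos
  have hS : ∀ u : Module.Dual (ZMod 2) V, ∃ e : ZMod 2, (u = 0 → e = 1) ∧
      (u ≠ 0 → ∃ k : ℕ, T ≤ k ∧ ∑ x with u x = e, g x = 2 ^ k) := by
    intro u
    by_cases hu : u = 0
    · exact ⟨1, fun _ => rfl, fun h => absurd hu h⟩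
    have hsp := half_split (fun _ => True) u 0 g
    simp only [true_and, Finset.filter_true, zero_add] at hsp
    have key : ∀ e : ZMod 2, 2 ^ T < 2 * ∑ x with u x = e, g x →
        ∃ k : ℕ, T ≤ k ∧ ∑ x with u x = e, g x = 2 ^ k := by
      intro e he
      have : (0 : ℤ) < 2 ^ T := by positivity
      obtain ⟨k, hk⟩ := hH u e hu (by linarith)
      refine ⟨k, pow_ge_of_gt ?_, hk⟩
      rw [pow_succ, ← hk]; linarith
    by_cases h0 : 2 ^ T < 2 * ∑ x with u x = 0, g x
    · exact ⟨0, fun h => absurd h hu, fun _ => key 0 h0⟩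
    · refine ⟨1, fun h => absurd h hu, fun _ => key 1 ?_⟩
      linarith
  choose s hs0 hs using hS
  have htri : ∀ u v : Module.Dual (ZMod 2) V, u ≠ 0 → v ≠ 0 → u ≠ v →
      s (u + v) = s u + s v + 1 := by
    intro u v hu hv huv
    by_contra hne
    have hstar : s (u + v) = s u + s v := by
      rw [← ne_eq, zmod2_ne_iff] at hne
      rw [hne, add_assoc, CharTwo.add_self_eq_zero, add_zero]
    have huv0 : u + v ≠ 0 := by
      intro h
      apply huv
      have h3 := eq_neg_of_add_eq_zero_left h
      rw [h3]
      ext x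
      simp [CharTwo.neg_eq]
    obtain ⟨x, hxT, hx⟩ := hs u hu
    obtain ⟨y, hyT, hy⟩ := hs v hv
    obtain ⟨z, hzT, hz⟩ := hs (u + v) huv0
    have A := half_split (fun _ => True) u (s u) g
    simp only [true_and, Finset.filter_true] at A
    have B := half_split (fun t => u t = s u) v (s v) g
    have C := half_split (fun t => u t = s u + 1) v (s v) g
    have D := half_split (fun t => v t = s v) u (s u) g
    have E := half_split (fun t => (u + v) t = s (u + v)) u (s u) g
    simp only [and_comm (a := v _ = _)] at D
    have e1 : ∀ t, ((u + v) t = s (u + v) ∧ u t = s u) ↔ (u t = s u ∧ v t = s v) := by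
      intro t
      rw [hstar, LinearMap.add_apply]
      generalize u t = a; generalize v t = b; generalize s u = c; generalize s v = d
      revert a b c d; decide
    have e2 : ∀ t, ((u + v) t = s (u + v) ∧ u t = s u + 1) ↔
        (u t = s u + 1 ∧ v t = s v + 1) := by
      intro t
      rw [hstar, LinearMap.add_apply]
      generalize u t = a; generalize v t = b; generalize s u = c; generalize s v = d
      revert a b c d; decide
    simp only [e1, e2] at E
    have B' : ∑ t with u t = s u ∧ v t = s v, g t + ∑ t with u t = s u ∧ v t = s v + 1, g t
        = 2 ^ x := by
      rw [← hx]; convert B.symm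
    have D' : ∑ t with u t = s u ∧ v t = s v, g t + ∑ t with u t = s u + 1 ∧ v t = s v, g t
        = 2 ^ y := by
      rw [← hy]; convert D.symm
    have E' : ∑ t with u t = s u ∧ v t = s v, g t + ∑ t with u t = s u + 1 ∧ v t = s v + 1, g t
        = 2 ^ z := by
      rw [← hz]; convert E.symm
    have C' : ∑ t with u t = s u + 1 ∧ v t = s v, g t +
        ∑ t with u t = s u + 1 ∧ v t = s v + 1, g t = ∑ t with u t = s u + 1, g t := by
      convert C.symm
    have A' : ∑ t with u t = s u, g t + ∑ t with u t = s u + 1, g t = ∑ t, g t := by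
      convert A.symm
    exact star_false B' D' E' hxT hyT hzT
      (hQ u v _ _ hu) (by rw [B', C', ← hx, A']) h1 h2
  have hadd : ∀ u v : Module.Dual (ZMod 2) V, s (u + v) + 1 = (s u + 1) + (s v + 1) := by
    intro u v
    have h11 : (1 : ZMod 2) + 1 = 0 := by decide
    by_cases hu : u = 0
    · rw [hs0 u hu, hu, zero_add, h11, zero_add]
    by_cases hv : v = 0
    · rw [hs0 v hv, hv, add_zero, h11, add_zero]
    by_cases huv : u = v
    · have : u + v = 0 := by
        rw [huv]; ext x; simp [CharTwo.add_self_eq_zero]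
      rw [hs0 _ this, huv, h11, CharTwo.add_self_eq_zero]
    · rw [htri u v hu hv huv]; ring
  let φ : Module.Dual (ZMod 2) V →+ ZMod 2 :=
    AddMonoidHom.mk' (fun u => s u + 1) hadd
  let L : Module.Dual (ZMod 2) (Module.Dual (ZMod 2) V) := φ.toZModLinearMap 2
  refine ⟨(Module.evalEquiv (ZMod 2) V).symm L, fun u hu => ?_⟩
  have : u ((Module.evalEquiv (ZMod 2) V).symm L) = s u + 1 := by
    rw [Module.apply_evalEquiv_symm_apply]; rfl
  rw [this, add_assoc, CharTwo.add_self_eq_zero, add_zero]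
  obtain ⟨k, hk, hk2⟩ := hs u hu
  rw [hk2]
  exact pow_le_pow_right₀ (by norm_num) hk

lemma exists_dual_one {V : Type} [AddCommGroup V] [Module (ZMod 2) V] {y : V} (hy : y ≠ 0) :
    ∃ u : Module.Dual (ZMod 2) V, u y = 1 := by
  by_contra hh
  push Not at hh
  apply hy
  rw [← Module.forall_dual_apply_eq_zero_iff (ZMod 2)]
  intro u
  exact (zmod2_cases (u y)).resolve_right (hh u)

open Classical in
lemma sum_halves {V : Type} [AddCommGroup V] [Module (ZMod 2) V] [Fintype V]
    [Fintype (Module.Dual (ZMod 2) V)]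
    (g : V → ℤ) (x0 : V) :
    2 * ∑ u : Module.Dual (ZMod 2) V, ∑ x with u x = u x0 + 1, g x =
      2 ^ (Module.finrank (ZMod 2) V) * (∑ x, g x - g x0) := by
  have hcard : ∀ x : V, x ≠ x0 →
      2 * ((Finset.univ.filter
        (fun u : Module.Dual (ZMod 2) V => u x = u x0 + 1)).card : ℤ) =
      2 ^ (Module.finrank (ZMod 2) V) := by
    intro x hx
    obtain ⟨u0, hu0⟩ := exists_dual_one (sub_ne_zero.2 hx)
    have e1 : (Finset.univ.filter (fun u : Module.Dual (ZMod 2) V => u x = u x0 + 1)).card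
        = (Finset.univ.filter (fun u : Module.Dual (ZMod 2) V => ¬ u x = u x0 + 1)).card := by
      have h0 : u0 x = u0 x0 + 1 := by
        rw [map_sub] at hu0
        rw [← hu0]; ring
      have hd : ∀ u : Module.Dual (ZMod 2) V, u + u0 + u0 = u := by
        intro u
        ext t
        simp [add_assoc, CharTwo.add_self_eq_zero]
      refine Finset.card_bij' (fun u _ => u + u0) (fun u _ => u + u0) ?_ ?_ ?_ ?_
      · intro u hu
        simp only [Finset.mem_filter, Finset.mem_univ, true_and, LinearMap.add_apply, h0] at hu ⊢
        rw [hu]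
        generalize u x0 = a; generalize u0 x0 = b
        revert a b; decide
      · intro u hu
        simp only [Finset.mem_filter, Finset.mem_univ, true_and, LinearMap.add_apply, h0] at hu ⊢
        revert hu
        generalize u x0 = a; generalize u0 x0 = b; generalize u x = c
        revert a b c; decide
      · intro u _; exact hd u
      · intro u _; exact hd u
    have e2 := Finset.card_filter_add_card_filter_not
      (s := (Finset.univ : Finset (Module.Dual (ZMod 2) V))) (fun u => u x = u x0 + 1)
    rw [← e1, Finset.card_univ, Module.card_eq_pow_finrank (K := ZMod 2), ZMod.card,
      Subspace.dual_finrank_eq] at e2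
    rw [two_mul]
    exact_mod_cast e2
  simp only [Finset.sum_filter]
  rw [Finset.sum_comm, Finset.mul_sum, ← Finset.add_sum_erase _ _ (Finset.mem_univ x0),
    ← Finset.add_sum_erase _ g (Finset.mem_univ x0), add_sub_cancel_left, Finset.mul_sum]
  have z : 2 * ∑ u : Module.Dual (ZMod 2) V, (if u x0 = u x0 + 1 then g x0 else 0) = 0 := by
    simp
  rw [Finset.mul_sum] at z
  rw [z, zero_add, Finset.mul_sum]
  refine Finset.sum_congr rfl ?_
  intro x hx
  rw [← hcard x (Finset.ne_of_mem_erase hx), ← Finset.sum_filter, Finset.sum_const, nsmul_eq_mul]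
  ring

open Classical in
lemma par_top {r : ℕ} {V : Type} [AddCommGroup V] [Module (ZMod 2) V] [Fintype V]
    {f : V → ZMod 2} (h : Par r f) (hr : r < Module.finrank (ZMod 2) V) : ∑ x, f x = 0 := by
  have := h ⊤ 0 (by rwa [finrank_top])
  rw [← this]
  symm
  exact Fintype.sum_equiv (Submodule.topEquiv (R := ZMod 2) (M := V)).toEquiv _ _ (by simp)

open Classical in
lemma min_dist (r n : ℕ) : ∀ {V : Type} [AddCommGroup V] [Module (ZMod 2) V] [Fintype V]
    (f : V → ZMod 2), Module.finrank (ZMod 2) V = n → Par r f → (∃ x, f x = 1) →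
    ∑ x, gg r (f x) ≤ 2 ^ n := by
  induction n with
  | zero =>
    intro V _ _ _ f hn hP ⟨x, hx⟩
    have hc : Fintype.card V = 1 := by
      rw [Module.card_eq_pow_finrank (K := ZMod 2), hn, pow_zero]
    obtain ⟨a, ha⟩ := Fintype.card_eq_one_iff.1 hc
    have : (Finset.univ : Finset V) = {x} := by
      ext y; simp [ha y, ha x]
    rw [this, Finset.sum_singleton, gg, if_pos hx]
    have : (1 : ℤ) ≤ 2 ^ r := one_le_pow₀ (by norm_num)
    simp only [pow_zero]; linarith
  | succ n ih =>
    intro V _ _ _ f hn hP ⟨x, hx⟩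
    by_cases hy : ∃ y, y ≠ x ∧ f y = 1
    · obtain ⟨y, hyx, hy⟩ := hy
      obtain ⟨u, hu⟩ := exists_dual_one (sub_ne_zero.2 hyx)
      have hu0 : u ≠ 0 := by rintro rfl; simp at hu
      have hfr := Module.Dual.finrank_ker_add_one_of_ne_zero hu0
      have a1 := ih (fun w : LinearMap.ker u => f (x + w)) (by omega)
        (par_restrict hP _ x) ⟨0, by simpa using hx⟩
      have a2 := ih (fun w : LinearMap.ker u => f (y + w)) (by omega)
        (par_restrict hP _ y) ⟨0, by simpa using hy⟩
      have b1 := flat_sum (LinearMap.ker u) x (fun t => gg r (f t))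
      have b2 := flat_sum (LinearMap.ker u) y (fun t => gg r (f t))
      have hsp := half_split (fun _ => True) u (u x) (fun t => gg r (f t))
      simp only [true_and, Finset.filter_true] at hsp
      have hyu : u y = u x + 1 := by
        rw [map_sub] at hu; rw [← hu]; ring
      simp only [LinearMap.mem_ker, map_sub, sub_eq_zero, hyu] at b1 b2
      rw [hsp, b1, b2, pow_succ]
      linarith
    · push Not at hy
      have h01 : ∀ t, t ≠ x → f t = 0 := fun t ht =>
        (zmod2_cases (f t)).resolve_right (hy t ht)
      have hr : n + 1 ≤ r := by
        by_contra hr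
        have := par_top hP (by omega)
        rw [Finset.sum_eq_single x (fun t _ ht => h01 t ht) (by simp), hx] at this
        exact absurd this (by decide)
      have e : ∑ t, gg r (f t) = ∑ t : V, (2 : ℤ) + ∑ t, (if t = x then -2 ^ r else 0 : ℤ) := by
        rw [← Finset.sum_add_distrib]
        refine Finset.sum_congr rfl fun t _ => ?_
        by_cases ht : t = x
        · simp [ht, hx, gg]; ring
        · simp [ht, h01 t ht, gg]
      rw [e, Finset.sum_ite_eq' Finset.univ x, if_pos (Finset.mem_univ x), Finset.sum_const,
        Finset.card_univ, Module.card_eq_pow_finrank (K := ZMod 2), hn, ZMod.card]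
      have : (2 : ℤ) ^ (n + 1) ≤ 2 ^ r := pow_le_pow_right₀ (by norm_num) hr
      simp only [nsmul_eq_mul]
      push_cast
      linarith

open Classical in
lemma sum_gg (r : ℕ) {V : Type} [AddCommGroup V] [Module (ZMod 2) V] [Fintype V]
    (f : V → ZMod 2) : ∑ x, gg r (f x) = 2 ^ (Module.finrank (ZMod 2) V + 1) -
      2 ^ r * ((Finset.univ.filter (fun x => f x = 1)).card : ℤ) := by
  have : ∀ x, gg r (f x) = 2 - 2 ^ r * (if f x = 1 then 1 else 0) := by
    intro x; unfold gg; split_ifs <;> ring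
  simp only [this]
  rw [Finset.sum_sub_distrib, ← Finset.mul_sum, Finset.sum_boole, Finset.sum_const,
        Finset.card_univ, Module.card_eq_pow_finrank (K := ZMod 2), ZMod.card]
  simp only [nsmul_eq_mul]
  push_cast
  ring

open Classical in
lemma main_pow (r n : ℕ) : ∀ {V : Type} [AddCommGroup V] [Module (ZMod 2) V] [Fintype V]
    (f : V → ZMod 2), Module.finrank (ZMod 2) V = n → Par r f →
    0 < ∑ x, gg r (f x) → ∃ k : ℕ, ∑ x, gg r (f x) = 2 ^ k := by
  induction n using Nat.strong_induction_on with
  | _ n ih =>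
  intro V _ _ _ f hn hP hpos
  by_contra hnp
  push Not at hnp
  by_cases hex : ∃ x, f x = 1
  swap
  · push Not at hex
    apply hnp (n + 1)
    rw [sum_gg, hn]
    simp [hex]
  have hmd := min_dist r n f hn hP hex
  obtain ⟨T, hT1, hT2⟩ : ∃ T : ℕ, 2 ^ T < ∑ x, gg r (f x) ∧ ∑ x, gg r (f x) < 2 ^ (T + 1) := by
    lift ∑ x, gg r (f x) to ℕ using hpos.le with C hC
    have hC0 : C ≠ 0 := by rintro rfl; simp at hpos
    refine ⟨Nat.log 2 C, lt_of_le_of_ne ?_ ?_, ?_⟩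
    · exact_mod_cast Nat.pow_log_le_self 2 hC0
    · exact (hnp _).symm
    · exact_mod_cast Nat.lt_pow_succ_log_self (by norm_num) C
  obtain ⟨x0, hx0⟩ := exists_center (fun x => gg r (f x)) (by
    intro W p hW hpos
    have hfs := flat_sum W p (fun x => gg r (f x))
    rw [hfs] at hpos ⊢
    exact ih _ (hn ▸ Submodule.finrank_lt hW) (fun w : W => f (p + w)) rfl
      (par_restrict hP W p) hpos) T hT1 hT2
  have : Finite (Module.Dual (ZMod 2) V) := Module.finite_of_finite (ZMod 2)
  have : Fintype (Module.Dual (ZMod 2) V) := Fintype.ofFinite _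
  have hsum := sum_halves (fun x => gg r (f x)) x0
  have hlow : (2 ^ n - 1) * 2 ^ T ≤
      ∑ u : Module.Dual (ZMod 2) V, ∑ x with u x = u x0 + 1, gg r (f x) := by
    rw [← Finset.add_sum_erase _ _ (Finset.mem_univ (0 : Module.Dual (ZMod 2) V))]
    have hz : ∑ x with (0 : Module.Dual (ZMod 2) V) x = (0 : Module.Dual (ZMod 2) V) x0 + 1,
        gg r (f x) = 0 := by simp
    rw [hz, zero_add]
    have := Finset.card_nsmul_le_sum (Finset.univ.erase (0 : Module.Dual (ZMod 2) V))
      (fun u => ∑ x with u x = u x0 + 1, gg r (f x)) (2 ^ T)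
      (fun u hu => hx0 u (Finset.ne_of_mem_erase hu))
    rw [Finset.card_erase_of_mem (Finset.mem_univ _), Finset.card_univ,
      Module.card_eq_pow_finrank (K := ZMod 2), ZMod.card, Subspace.dual_finrank_eq, hn,
      nsmul_eq_mul, Nat.cast_sub Nat.one_le_two_pow] at this
    exact_mod_cast this
  have hx0g : 2 - 2 ^ r ≤ gg r (f x0) := by
    have : (0 : ℤ) < 2 ^ r := by positivity
    unfold gg; split_ifs <;> linarith
  have hgap : ∑ x, gg r (f x) + 2 ^ r ≤ 2 ^ (T + 1) := by
    have hs := sum_gg r f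
    rw [hn] at hs
    have hN : 1 ≤ ((Finset.univ.filter (fun x => f x = 1)).card : ℤ) := by
      obtain ⟨x, hx⟩ := hex
      exact_mod_cast Finset.card_pos.2 ⟨x, by simpa using hx⟩
    have hr0 : (0 : ℤ) < 2 ^ r := by positivity
    have hrn : (2 : ℤ) ^ r < 2 ^ (n + 1) := by nlinarith
    have hrn' := pow_ge_of_gt hrn
    have hd : (2 : ℤ) ^ r ∣ ∑ x, gg r (f x) := by
      rw [hs]
      exact dvd_sub (pow_dvd_pow _ (by omega)) (dvd_mul_right _ _)
    have hle := Int.le_of_dvd hpos hd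
    have hrT := pow_ge_of_gt (lt_of_le_of_lt hle hT2)
    have hd2 : (2 : ℤ) ^ r ∣ 2 ^ (T + 1) - ∑ x, gg r (f x) :=
      dvd_sub (pow_dvd_pow _ (by omega)) hd
    have := Int.le_of_dvd (by linarith) hd2
    linarith
  have hTn : (2 : ℤ) ^ T < 2 ^ n := lt_of_lt_of_le hT1 hmd
  rw [hn] at hsum
  have hfin : 2 ^ n * (∑ x, gg r (f x) - gg r (f x0)) ≤ (2 : ℤ) ^ n * (2 ^ (T + 1) - 2) :=
    mul_le_mul_of_nonneg_left (by linarith) (by positivity)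
  have e : (2 : ℤ) ^ (T + 1) = 2 * 2 ^ T := by ring
  rw [e] at hfin
  nlinarith

lemma totalDegree_aeval_le {σ τ : Type} (P : MvPolynomial σ (ZMod 2))
    (q : σ → MvPolynomial τ (ZMod 2)) (hq : ∀ i, (q i).totalDegree ≤ 1) :
    (MvPolynomial.aeval q P).totalDegree ≤ P.totalDegree := by
  rw [MvPolynomial.aeval_def, MvPolynomial.eval₂_eq]
  refine (MvPolynomial.totalDegree_finsetSum _ _).trans (Finset.sup_le fun d hd => ?_)
  refine (MvPolynomial.totalDegree_mul _ _).trans ?_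
  rw [MvPolynomial.algebraMap_eq, MvPolynomial.totalDegree_C, zero_add]
  refine (MvPolynomial.totalDegree_finsetProd _ _).trans ?_
  refine le_trans (Finset.sum_le_sum fun i _ => ?_) (MvPolynomial.le_totalDegree hd)
  refine (MvPolynomial.totalDegree_pow _ _).trans ?_
  exact (Nat.mul_le_mul_left _ (hq i)).trans (by simp)

lemma par_of_RM {r v : ℕ} {f : (Fin v → ZMod 2) → ZMod 2} (hf : RM r v f) : Par r f := by
  classical
  obtain ⟨P, hP, hPf⟩ := hf
  intro W p hW
  let b := Module.finBasis (ZMod 2) W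
  let q : Fin v → MvPolynomial (Fin (Module.finrank (ZMod 2) W)) (ZMod 2) := fun i =>
    MvPolynomial.C (p i) + ∑ j, MvPolynomial.C ((b j : Fin v → ZMod 2) i) * MvPolynomial.X j
  have hq : ∀ i, (q i).totalDegree ≤ 1 := by
    intro i
    refine (MvPolynomial.totalDegree_add _ _).trans (max_le (by simp) ?_)
    refine (MvPolynomial.totalDegree_finsetSum _ _).trans (Finset.sup_le fun j _ => ?_)
    refine (MvPolynomial.totalDegree_mul _ _).trans ?_
    simp
  have hz := MvPolynomial.sum_eval_eq_zero (MvPolynomial.aeval q P) (by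
    have := totalDegree_aeval_le P q hq
    simp only [ZMod.card, Fintype.card_fin]
    omega)
  rw [← hz]
  refine Fintype.sum_equiv b.equivFun.toEquiv _ _ fun w => ?_
  have hev : ∀ x, MvPolynomial.eval x (MvPolynomial.aeval q P) =
      MvPolynomial.eval (fun i => MvPolynomial.eval x (q i)) P := fun x =>
    MvPolynomial.eval₂Hom_bind₁ (RingHom.id _) x q P
  rw [← hPf, hev]
  congr 2
  ext i
  have hw : (w : Fin v → ZMod 2) i = ∑ j, b.equivFun w j * (b j : Fin v → ZMod 2) i := by
    have h3 := congrArg (fun z : W => (z : Fin v → ZMod 2) i) (b.sum_equivFun w)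
    rw [← h3]
    simp only [Submodule.coe_sum, Submodule.coe_smul, Finset.sum_apply, Pi.smul_apply,
      smul_eq_mul]
  simp only [q, map_add, map_sum, map_mul, MvPolynomial.eval_C, MvPolynomial.eval_X, Pi.add_apply]
  rw [hw]
  congr 1
  exact Finset.sum_congr rfl fun j _ => mul_comm _ _

/-- Berlekamp–Sloane: a nonzero weight of a codeword of `RM(r,v)`
that is less than `2^(v-r+1)` equals `2^(v-r+1) - 2^j` for some `j ∈ {1,…,v-r}`. -/
theorem RM_small_weights (v r : ℕ) (hrv : r < v)
    (f : (Fin v → ZMod 2) → ZMod 2) (hf : RM r v f)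
    (h0 : weight f ≠ 0) (h1 : weight f < 2 ^ (v - r + 1)) :
    ∃ j, 1 ≤ j ∧ j ≤ v - r ∧ weight f = 2 ^ (v - r + 1) - 2 ^ j := by
  have hP := par_of_RM hf
  have hfr : Module.finrank (ZMod 2) (Fin v → ZMod 2) = v := by simp
  have hs := sum_gg r f
  have hw : (((Finset.univ.filter (fun x => f x = 1)).card : ℕ) : ℤ) = (weight f : ℤ) := by
    unfold weight; congr
  rw [hfr, hw] at hs
  have hex : ∃ x, f x = 1 := by
    by_contra hh
    push Not at hh
    apply h0
    simp [weight, hh]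
  have hmd := min_dist r v f hfr hP hex
  have hsplit : (2 : ℤ) ^ (v + 1) = 2 ^ r * 2 ^ (v - r + 1) := by
    rw [← pow_add]; congr 1; omega
  have hfac : ∑ x, gg r (f x) = 2 ^ r * (2 ^ (v - r + 1) - (weight f : ℤ)) := by
    rw [hs, hsplit]; ring
  have h1' : (weight f : ℤ) < 2 ^ (v - r + 1) := by exact_mod_cast h1
  have hr0 : (0 : ℤ) < 2 ^ r := by positivity
  obtain ⟨k, hk⟩ := main_pow r v f hfr hP (by
    rw [hfac]; exact mul_pos hr0 (by linarith))
  rw [hk] at hmd hfac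
  have hkv : k ≤ v := (pow_le_pow_iff_right₀ (by norm_num : (1 : ℤ) < 2)).1 hmd
  have hrk : r ≤ k := by
    apply (pow_le_pow_iff_right₀ (by norm_num : (1 : ℤ) < 2)).1
    exact Int.le_of_dvd (by positivity) ⟨_, hfac⟩
  have hj : (2 : ℤ) ^ (k - r) = 2 ^ (v - r + 1) - (weight f : ℤ) := by
    have : (2 : ℤ) ^ k = 2 ^ r * 2 ^ (k - r) := by rw [← pow_add]; congr 1; omega
    rw [this] at hfac
    exact mul_left_cancel₀ hr0.ne' hfac
  have hj' : 2 ^ (k - r) + weight f = 2 ^ (v - r + 1) := by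
    have : (2 : ℤ) ^ (k - r) + (weight f : ℤ) = 2 ^ (v - r + 1) := by linarith
    exact_mod_cast this
  have heven : Even (weight f) := by
    have hz := par_top hP (by rw [hfr]; exact hrv)
    have e : ∑ x, f x = ((weight f : ℕ) : ZMod 2) := by
      unfold weight
      rw [← Finset.sum_boole]
      refine Finset.sum_congr rfl fun x _ => ?_
      rcases zmod2_cases (f x) with h | h <;> simp [h]
    rw [e] at hz
    exact (ZMod.natCast_eq_zero_iff_even).1 hz
  refine ⟨k - r, ?_, by omega, by omega⟩
  by_contra hlt
  have : k - r = 0 := by omega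
  rw [this, pow_zero, pow_succ] at hj'
  obtain ⟨a, ha⟩ := heven
  omega
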